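/- For every real t ≠ 0, ∫_0^∞ (e^{itx} - 1 - itx·1_{x<1}) x^{-2} dx = -π|t|/2 - i t ln|t| + i t (1 - γ), where γ is Euler's constant. -/

import Mathlib

open MeasureTheory Real
open scoped Real

section

open Filter Topology Set

lemma norm_exp_neg_sub_one_le {w : ℂ} (hw : 0 ≤ w.re) : ‖Complex.exp (-w) - 1‖ ≤ 2 * ‖w‖ := by
  rcases le_total ‖w‖ 1 with h | h
  · simpa using Complex.norm_exp_sub_one_le (x := -w) (by simpa using h)
  · have h1 : ‖Complex.exp (-w)‖ ≤ 1 := by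
      rw [Complex.norm_exp]; simpa using hw
    have h2 := norm_sub_le (Complex.exp (-w)) 1
    rw [norm_one] at h2
    linarith

lemma norm_exp_neg_sub_one_add_self_le {w : ℂ} (hw : 0 ≤ w.re) :
    ‖Complex.exp (-w) - 1 + w‖ ≤ 3 * ‖w‖ ^ 2 := by
  rcases le_total ‖w‖ 1 with h | h
  · have := Complex.norm_exp_sub_one_sub_id_le (x := -w) (by simpa using h)
    rw [sub_neg_eq_add, norm_neg] at this
    nlinarith [sq_nonneg ‖w‖]
  · have h1 := norm_exp_neg_sub_one_le hw
    have h2 := norm_add_le (Complex.exp (-w) - 1) w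
    nlinarith

/-- The compensated exponential `(e^{-zx} - 1 + zx 1_{x<1}) / x²` of the Lévy exponent. -/
noncomputable def compensatedExp (z : ℂ) (x : ℝ) : ℂ :=
  (Complex.exp (-(z * x)) - 1 + z * x * (if x < 1 then 1 else 0)) / (x : ℂ) ^ 2

lemma measurable_compensatedExp (z : ℂ) : Measurable (compensatedExp z) := by
  unfold compensatedExp
  have : Measurable fun x : ℝ => (if x < 1 then (1 : ℂ) else 0) :=
    Measurable.ite measurableSet_Iio measurable_const measurable_const
  fun_prop

lemma norm_compensatedExp_le {z : ℂ} {M : ℝ} (hz : 0 ≤ z.re) (hM : ‖z‖ ≤ M) {x : ℝ}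
    (hx : 0 < x) : ‖compensatedExp z x‖ ≤ (6 * M ^ 2 + 4) * (1 + x ^ 2)⁻¹ := by
  have hre : 0 ≤ (z * x).re := by
    rw [Complex.re_mul_ofReal]; positivity
  have hnx : ‖((x : ℂ)) ^ 2‖ = x ^ 2 := by simp
  have hzM : ‖z‖ ^ 2 ≤ M ^ 2 := by gcongr
  rw [compensatedExp, norm_div, hnx, ← div_eq_mul_inv,
    div_le_div_iff₀ (by positivity) (by positivity)]
  split_ifs with h
  · have h1 := norm_exp_neg_sub_one_add_self_le hre
    rw [norm_mul, Complex.norm_real, norm_eq_abs, mul_pow, sq_abs] at h1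
    rw [mul_one]
    have hx1 : x ^ 2 ≤ 1 := by nlinarith
    calc _ ≤ (3 * (‖z‖ ^ 2 * x ^ 2)) * (1 + x ^ 2) := by gcongr
      _ ≤ (3 * (M ^ 2 * x ^ 2)) * (1 + 1) := by gcongr
      _ ≤ _ := by nlinarith [sq_nonneg x]
  · have h1 : ‖Complex.exp (-(z * x))‖ ≤ 1 := by
      rw [Complex.norm_exp]; simpa using hre
    have h2 := norm_sub_le (Complex.exp (-(z * x))) 1
    rw [norm_one] at h2
    rw [mul_zero, add_zero]
    have hx1 : 1 ≤ x ^ 2 := by nlinarith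
    calc _ ≤ 2 * (1 + x ^ 2) := by gcongr; linarith
      _ ≤ _ := by nlinarith [mul_nonneg (sq_nonneg M) (sq_nonneg x)]

lemma integrableOn_compensatedExp {z : ℂ} (hz : 0 ≤ z.re) :
    IntegrableOn (compensatedExp z) (Ioi 0) := by
  refine Integrable.mono' (integrable_inv_one_add_sq.integrableOn.const_mul (6 * ‖z‖ ^ 2 + 4))
    (measurable_compensatedExp z).aestronglyMeasurable ?_
  filter_upwards [ae_restrict_mem measurableSet_Ioi] with x hx
  exact norm_compensatedExp_le hz le_rfl hx

lemma continuousWithinAt_integral_compensatedExp (z₀ : ℂ) :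
    ContinuousWithinAt (fun z => ∫ x in Ioi (0 : ℝ), compensatedExp z x) {z | 0 ≤ z.re} z₀ := by
  refine tendsto_integral_filter_of_dominated_convergence
    (fun x => (6 * (‖z₀‖ + 1) ^ 2 + 4) * (1 + x ^ 2)⁻¹)
    (.of_forall fun z => (measurable_compensatedExp z).aestronglyMeasurable) ?_
    (integrable_inv_one_add_sq.integrableOn.const_mul _) ?_
  · have hn : ∀ᶠ z in 𝓝[{z | 0 ≤ z.re}] z₀, ‖z‖ ≤ ‖z₀‖ + 1 :=
      nhdsWithin_le_nhds (continuous_norm.continuousAt.eventually_le_const (by simp))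
    filter_upwards [hn, self_mem_nhdsWithin] with z hz hz'
    filter_upwards [ae_restrict_mem measurableSet_Ioi] with x hx
    exact norm_compensatedExp_le hz' hz hx
  · refine .of_forall fun x => ?_
    have : Continuous fun z => compensatedExp z x := by
      unfold compensatedExp
      fun_prop
    exact this.continuousWithinAt

/-- The kernel `(1_{x<1} - e^{-zx}) / x`, the `z`-derivative of `compensatedExp`. -/
noncomputable def truncatedExpDiv (z : ℂ) (x : ℝ) : ℂ :=
  ((if x < 1 then 1 else 0) - Complex.exp (-(z * x))) / x

lemma measurable_truncatedExpDiv (z : ℂ) : Measurable (truncatedExpDiv z) := by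
  unfold truncatedExpDiv
  have : Measurable fun x : ℝ => (if x < 1 then (1 : ℂ) else 0) :=
    Measurable.ite measurableSet_Iio measurable_const measurable_const
  fun_prop

lemma norm_truncatedExpDiv_le {z : ℂ} (hz : 0 < z.re) {x : ℝ} (hx : 0 < x) :
    ‖truncatedExpDiv z x‖ ≤ (2 * ‖z‖ * exp z.re + 1) * exp (-z.re * x) := by
  have hre : 0 ≤ (z * x).re := by
    rw [Complex.re_mul_ofReal]; positivity
  rw [truncatedExpDiv, norm_div, Complex.norm_real, norm_eq_abs, abs_of_pos hx, div_le_iff₀ hx]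
  split_ifs with h
  · have h1 := norm_exp_neg_sub_one_le hre
    rw [norm_mul, Complex.norm_real, norm_eq_abs, abs_of_pos hx, norm_sub_rev] at h1
    have h2 : 1 ≤ exp z.re * exp (-z.re * x) := by
      rw [← exp_add]; apply one_le_exp; nlinarith
    have h3 : 0 ≤ 2 * ‖z‖ * x := by positivity
    have h4 : 0 ≤ exp (-z.re * x) * x := by positivity
    nlinarith
  · rw [zero_sub, norm_neg, Complex.norm_exp]
    have : (-(z * x)).re = -z.re * x := by simp
    rw [this]
    have h3 : 0 ≤ 2 * ‖z‖ * exp z.re := by positivity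
    have h4 : 0 < exp (-z.re * x) := by positivity
    have h5 := mul_nonneg h3 h4.le
    nlinarith [mul_nonneg h5 hx.le]

lemma integrableOn_truncatedExpDiv {z : ℂ} (hz : 0 < z.re) :
    IntegrableOn (truncatedExpDiv z) (Ioi 0) := by
  refine Integrable.mono' ((exp_neg_integrableOn_Ioi 0 hz).const_mul (2 * ‖z‖ * exp z.re + 1))
    (measurable_truncatedExpDiv z).aestronglyMeasurable ?_
  filter_upwards [ae_restrict_mem measurableSet_Ioi] with x hx
  exact norm_truncatedExpDiv_le hz hx

lemma hasDerivAt_integral_truncatedExpDiv {z : ℂ} (hz : 0 < z.re) :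
    HasDerivAt (fun z => ∫ x in Ioi (0 : ℝ), truncatedExpDiv z x) z⁻¹ z := by
  have hs : {w : ℂ | z.re / 2 < w.re} ∈ 𝓝 z :=
    (isOpen_lt continuous_const Complex.continuous_re).mem_nhds (by simp [hz])
  have key := (hasDerivAt_integral_of_dominated_loc_of_deriv_le (𝕜 := ℂ)
    (μ := volume.restrict (Ioi (0 : ℝ))) (F := truncatedExpDiv)
    (F' := fun w x => Complex.exp (-(w * x))) (bound := fun x => exp (-(z.re / 2) * x)) hs
    (.of_forall fun w => (measurable_truncatedExpDiv w).aestronglyMeasurable)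
    (integrableOn_truncatedExpDiv hz) (by fun_prop) ?_
    (exp_neg_integrableOn_Ioi 0 (half_pos hz)) ?_).2
  · have := integral_exp_mul_complex_Ioi (a := -z) (by simpa using hz) 0
    simp only [neg_mul] at this
    rw [this] at key
    simpa using key
  · filter_upwards [ae_restrict_mem measurableSet_Ioi] with x hx w hw
    rw [Complex.norm_exp, exp_le_exp]
    simp only [Complex.neg_re, Complex.re_mul_ofReal]
    have hw' : z.re / 2 < w.re := hw
    have hx' : 0 < x := hx
    nlinarith
  · filter_upwards [ae_restrict_mem measurableSet_Ioi] with x hx w _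
    have hx' : (x : ℂ) ≠ 0 := by exact_mod_cast (ne_of_gt hx)
    have := ((((hasDerivAt_id w).mul_const (x : ℂ)).neg.cexp).const_sub
      (if x < 1 then (1 : ℂ) else 0)).div_const (x : ℂ)
    refine this.congr_deriv ?_
    simp
    field_simp

lemma tendsto_Gamma_sub_inv : Tendsto (fun s : ℝ => 1 / s - Gamma s) (𝓝[>] 0)
    (𝓝 eulerMascheroniConstant) := by
  have h := hasDerivAt_iff_tendsto_slope_zero.1 hasDerivAt_Gamma_one
  have h' := (h.mono_left (nhdsGT_le_nhdsNE 0)).neg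
  rw [neg_neg] at h'
  refine h'.congr' ?_
  filter_upwards [self_mem_nhdsWithin] with s hs
  have hs' : s ≠ 0 := ne_of_gt hs
  rw [add_comm, Gamma_add_one hs', Gamma_one, smul_eq_mul]
  field_simp
  ring

lemma integral_rpow_mul_truncated {s : ℝ} (hs : 0 < s) :
    ∫ x in Ioi (0 : ℝ), x ^ s * (((if x < 1 then 1 else 0) - exp (-x)) / x) =
      1 / s - Gamma s := by
  have h1 : ∫ x in Ioi (0 : ℝ), (Ioo (0 : ℝ) 1).indicator (fun x => x ^ (s - 1)) x = 1 / s := by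
    rw [setIntegral_indicator measurableSet_Ioo, inter_eq_right.2 Ioo_subset_Ioi_self,
      ← integral_Ioc_eq_integral_Ioo, ← intervalIntegral.integral_of_le zero_le_one,
      integral_rpow (Or.inl (by linarith))]
    simp [hs.ne']
  have i1 : IntegrableOn ((Ioo (0 : ℝ) 1).indicator (fun x => x ^ (s - 1))) (Ioi 0) := by
    refine IntegrableOn.integrable_indicator ?_ measurableSet_Ioo |>.integrableOn
    exact (intervalIntegral.integrableOn_Ioo_rpow_iff zero_lt_one).2 (by linarith)
  rw [Gamma_eq_integral hs, ← h1, ← integral_sub i1 (GammaIntegral_convergent hs)]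
  refine setIntegral_congr_fun measurableSet_Ioi fun x hx => ?_
  have hx' : 0 < x := hx
  simp only [indicator, mem_Ioo, hx', true_and]
  rw [rpow_sub_one hx'.ne']
  split_ifs <;> ring

lemma integral_truncatedExpDiv_one :
    ∫ x in Ioi (0 : ℝ), truncatedExpDiv 1 x = eulerMascheroniConstant := by
  set f : ℝ → ℝ := fun x => ((if x < 1 then 1 else 0) - exp (-x)) / x with hf
  have hcast : ∀ x, truncatedExpDiv 1 x = (f x : ℂ) := by
    intro x
    simp only [truncatedExpDiv, f]
    split_ifs <;> push_cast <;> simp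
  have hint : IntegrableOn f (Ioi 0) := by
    have := (integrableOn_truncatedExpDiv (z := 1) (by simp)).re
    simp only [hcast, RCLike.re_to_complex, Complex.ofReal_re] at this
    exact this
  simp_rw [hcast]
  rw [integral_complex_ofReal]
  congr 1
  refine tendsto_nhds_unique (f := fun s : ℝ => ∫ x in Ioi (0 : ℝ), x ^ s * f x)
    (l := 𝓝[>] 0) ?_
    (tendsto_Gamma_sub_inv.congr' ?_)
  · refine tendsto_integral_filter_of_dominated_convergence
      (fun x => 2 * (2 * exp 1 + 1) * exp (-(1 / 2) * x)) (.of_forall fun s => ?_) ?_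
      ((exp_neg_integrableOn_Ioi 0 one_half_pos).const_mul _) ?_
    · exact (measurable_id.pow_const s).aestronglyMeasurable.mul hint.aestronglyMeasurable
    · filter_upwards [Ioo_mem_nhdsGT zero_lt_one] with s hs
      filter_upwards [ae_restrict_mem measurableSet_Ioi] with x hx
      have hx' : 0 < x := hx
      have h1 : ‖f x‖ ≤ (2 * exp 1 + 1) * exp (-x) := by
        have := norm_truncatedExpDiv_le (z := 1) (by simp) hx'
        rw [hcast, Complex.norm_real] at this
        simpa using this
      have h2 : x ^ s ≤ 2 * exp (x / 2) := by
        have h3 : x ^ s ≤ 1 + x := by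
          rcases le_total x 1 with h | h
          · linarith [rpow_le_one hx'.le h hs.1.le]
          · linarith [rpow_le_self_of_one_le h hs.2.le]
        linarith [add_one_le_exp (x / 2)]
      rw [norm_mul, norm_eq_abs (x ^ s), abs_of_pos (rpow_pos_of_pos hx' s)]
      calc _ ≤ 2 * exp (x / 2) * ((2 * exp 1 + 1) * exp (-x)) := by gcongr
        _ = 2 * (2 * exp 1 + 1) * (exp (x / 2) * exp (-x)) := by ring
        _ = _ := by rw [← exp_add]; ring_nf
    · filter_upwards [ae_restrict_mem measurableSet_Ioi] with x hx
      have : Tendsto (fun s : ℝ => x ^ s) (𝓝 0) (𝓝 (x ^ (0 : ℝ))) :=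
        (continuousAt_const_rpow (ne_of_gt hx)).tendsto
      rw [rpow_zero] at this
      simpa using (this.mono_left nhdsWithin_le_nhds).mul_const (f x)
  · filter_upwards [self_mem_nhdsWithin] with s hs
    exact (integral_rpow_mul_truncated hs).symm

lemma integral_truncatedExpDiv {z : ℂ} (hz : 0 < z.re) :
    ∫ x in Ioi (0 : ℝ), truncatedExpDiv z x = Complex.log z + eulerMascheroniConstant := by
  have hd : ∀ w ∈ {w : ℂ | 0 < w.re},
      HasDerivAt (fun w => Complex.log w + eulerMascheroniConstant) w⁻¹ w := fun w hw =>
    (Complex.hasDerivAt_log (Or.inl hw)).add_const _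
  refine (isOpen_lt continuous_const Complex.continuous_re).eqOn_of_deriv_eq
    (convex_halfSpace_re_gt 0).isPreconnected
    (fun w hw => (hasDerivAt_integral_truncatedExpDiv hw).differentiableAt.differentiableWithinAt)
    (fun w hw => (hd w hw).differentiableAt.differentiableWithinAt)
    (fun w hw => ?_) (x := 1) (by simp) ?_ hz
  · rw [(hasDerivAt_integral_truncatedExpDiv hw).deriv, (hd w hw).deriv]
  · simp [integral_truncatedExpDiv_one]

lemma hasDerivAt_one_sub_exp_div (z c : ℂ) {x : ℝ} (hx : 0 < x) :
    HasDerivAt (fun x : ℝ => (1 - Complex.exp (-(z * x)) - c * x) / x)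
      ((Complex.exp (-(z * x)) - 1) / x ^ 2 + z * (Complex.exp (-(z * x)) / x)) x := by
  have hx' : (x : ℂ) ≠ 0 := by exact_mod_cast hx.ne'
  have h0 : HasDerivAt (fun y : ℝ => (y : ℂ)) 1 x := Complex.ofRealCLM.hasDerivAt
  have := (((h0.const_mul z).neg.cexp.const_sub 1).sub (h0.const_mul c)).div h0 hx'
  refine this.congr_deriv ?_
  simp
  field_simp
  ring

lemma setIntegral_Ioi_one_compensatedExp {z : ℂ} (hz : 0 < z.re) :
    ∫ x in Ioi (1 : ℝ), (compensatedExp z x - z * truncatedExpDiv z x) =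
      Complex.exp (-z) - 1 := by
  have hsub : Ioi (1 : ℝ) ⊆ Ioi 0 := Ioi_subset_Ioi zero_le_one
  have hcongr : EqOn (fun x => compensatedExp z x - z * truncatedExpDiv z x)
      (fun x : ℝ => (Complex.exp (-(z * x)) - 1) / x ^ 2 + z * (Complex.exp (-(z * x)) / x))
      (Ioi 1) := by
    intro x hx
    simp only [compensatedExp, truncatedExpDiv, if_neg (not_lt.2 (le_of_lt (mem_Ioi.1 hx)))]
    ring
  have hint : IntegrableOn (fun x => compensatedExp z x - z * truncatedExpDiv z x) (Ioi 1) :=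
    ((integrableOn_compensatedExp hz.le).mono_set hsub).sub
      (((integrableOn_truncatedExpDiv hz).mono_set hsub).const_mul z)
  rw [setIntegral_congr_fun measurableSet_Ioi hcongr,
    integral_Ioi_of_hasDerivAt_of_tendsto' (m := 0)
      (fun x hx => hasDerivAt_one_sub_exp_div z 0 (zero_lt_one.trans_le hx))
      (hint.congr_fun hcongr measurableSet_Ioi)]
  · simp
  · refine squeeze_zero_norm' (a := fun x : ℝ => 2 / x) ?_ (tendsto_const_nhds.div_atTop tendsto_id)
    filter_upwards [eventually_gt_atTop 0] with x hx
    rw [norm_div, Complex.norm_real, norm_eq_abs, abs_of_pos hx]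
    have h1 : ‖Complex.exp (-(z * x))‖ ≤ 1 := by
      rw [Complex.norm_exp]; simp; positivity
    have h2 := norm_sub_le 1 (Complex.exp (-(z * x)))
    rw [norm_one] at h2
    gcongr
    simp only [zero_mul, sub_zero]
    linarith

lemma setIntegral_Ioc_compensatedExp {z : ℂ} (hz : 0 < z.re) :
    ∫ x in Ioc (0 : ℝ) 1, (compensatedExp z x - z * truncatedExpDiv z x) =
      1 - Complex.exp (-z) - z := by
  have hcongr : EqOn (fun x => compensatedExp z x - z * truncatedExpDiv z x)
      (fun x : ℝ => (Complex.exp (-(z * x)) - 1) / x ^ 2 + z * (Complex.exp (-(z * x)) / x))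
      (Ioo 0 1) := by
    intro x hx
    have hx' : (x : ℂ) ≠ 0 := by exact_mod_cast hx.1.ne'
    simp only [compensatedExp, truncatedExpDiv, if_pos hx.2]
    field_simp
    ring
  have hint : IntegrableOn (fun x => compensatedExp z x - z * truncatedExpDiv z x) (Ioo 0 1) :=
    ((integrableOn_compensatedExp hz.le).mono_set Ioo_subset_Ioi_self).sub
      (((integrableOn_truncatedExpDiv hz).mono_set Ioo_subset_Ioi_self).const_mul z)
  have hcont := (hasDerivAt_one_sub_exp_div z z zero_lt_one).continuousAt
  rw [integral_Ioc_eq_integral_Ioo, setIntegral_congr_fun measurableSet_Ioo hcongr,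
    ← integral_Ioc_eq_integral_Ioo, ← intervalIntegral.integral_of_le zero_le_one,
    intervalIntegral.integral_eq_sub_of_hasDerivAt_of_tendsto zero_lt_one (fa := 0)
      (fun x hx => hasDerivAt_one_sub_exp_div z z hx.1) _ _ (hcont.mono_left nhdsWithin_le_nhds)]
  · simp
  · rw [intervalIntegrable_iff_integrableOn_Ioo_of_le zero_le_one]
    exact hint.congr_fun hcongr measurableSet_Ioo
  · refine squeeze_zero_norm' (a := fun x : ℝ => 3 * ‖z‖ ^ 2 * x) ?_ ?_
    · filter_upwards [self_mem_nhdsWithin] with x hx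
      have hx' : 0 < x := hx
      have h1 := norm_exp_neg_sub_one_add_self_le (w := z * x) (by
        rw [Complex.re_mul_ofReal]; positivity)
      rw [norm_div, Complex.norm_real, norm_eq_abs, abs_of_pos hx', div_le_iff₀ hx', ← norm_neg]
      rw [norm_mul, Complex.norm_real, norm_eq_abs, mul_pow, sq_abs] at h1
      calc _ = ‖Complex.exp (-(z * x)) - 1 + z * x‖ := by congr 1; ring
        _ ≤ _ := h1
        _ = _ := by ring
    · have : Tendsto (fun x : ℝ => 3 * ‖z‖ ^ 2 * x) (𝓝 0) (𝓝 (3 * ‖z‖ ^ 2 * 0)) :=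
        tendsto_id.const_mul _
      rw [mul_zero] at this
      exact this.mono_left nhdsWithin_le_nhds

lemma integral_compensatedExp_of_re_pos {z : ℂ} (hz : 0 < z.re) :
    ∫ x in Ioi (0 : ℝ), compensatedExp z x =
      z * (Complex.log z + eulerMascheroniConstant - 1) := by
  have hF := integrableOn_compensatedExp hz.le
  have hG := (integrableOn_truncatedExpDiv hz).const_mul z
  have hint : IntegrableOn (fun x => compensatedExp z x - z * truncatedExpDiv z x) (Ioi 0) :=
    hF.sub hG
  have h : ∫ x in Ioi (0 : ℝ), (compensatedExp z x - z * truncatedExpDiv z x) = -z := by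
    rw [← Ioc_union_Ioi_eq_Ioi (zero_le_one' ℝ),
      setIntegral_union Ioc_disjoint_Ioi_same measurableSet_Ioi
        (hint.mono_set Ioc_subset_Ioi_self) (hint.mono_set (Ioi_subset_Ioi zero_le_one)),
      setIntegral_Ioc_compensatedExp hz, setIntegral_Ioi_one_compensatedExp hz]
    ring
  rw [integral_sub hF hG, integral_const_mul, integral_truncatedExpDiv hz] at h
  linear_combination h

lemma integral_compensatedExp {z : ℂ} (hz : 0 ≤ z.re) (hz' : z ∈ Complex.slitPlane) :
    ∫ x in Ioi (0 : ℝ), compensatedExp z x =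
      z * (Complex.log z + eulerMascheroniConstant - 1) := by
  have hu : Tendsto (fun ε : ℝ => z + ε) (𝓝[>] 0) (𝓝 z) := by
    have : Tendsto (fun ε : ℝ => z + ε) (𝓝 0) (𝓝 (z + (0 : ℝ))) := by
      apply Continuous.tendsto; fun_prop
    rw [Complex.ofReal_zero, add_zero] at this
    exact this.mono_left nhdsWithin_le_nhds
  have hre : ∀ᶠ ε : ℝ in 𝓝[>] 0, 0 < (z + ε).re := by
    filter_upwards [self_mem_nhdsWithin] with ε hε
    have : 0 < ε := hε
    simp only [Complex.add_re, Complex.ofReal_re]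
    linarith
  have hL := (continuousWithinAt_integral_compensatedExp z).tendsto.comp
    (tendsto_nhdsWithin_iff.2 ⟨hu, hre.mono fun _ h => le_of_lt h⟩)
  have hR : ContinuousAt (fun w => w * (Complex.log w + eulerMascheroniConstant - 1)) z :=
    continuousAt_id.mul (((continuousAt_clog hz').add_const _).sub_const _)
  refine tendsto_nhds_unique hL ((hR.tendsto.comp hu).congr' ?_)
  filter_upwards [hre] with ε hε
  exact (integral_compensatedExp_of_re_pos hε).symm

end

/-- Lévy–Khintchine exponent of the completely asymmetric 1-stable law with Lévy
measure `x⁻² dx` on `(0,∞)`: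
`∫_0^∞ (e^{itx} - 1 - itx 1_{x<1}) x⁻² dx = -π|t|/2 - it ln|t| + it(1-γ)`. -/
theorem stable_cauchy_levy_exponent (t : ℝ) (ht : t ≠ 0) :
    ∫ x in Set.Ioi (0 : ℝ),
        (Complex.exp (Complex.I * t * x) - 1
          - Complex.I * t * x * (if x < 1 then 1 else 0)) / (x : ℂ) ^ 2
      = -(π * |t| / 2 : ℝ) - Complex.I * t * Real.log |t|
        + Complex.I * t * (1 - Real.eulerMascheroniConstant) := by
  have key := integral_compensatedExp (z := -(Complex.I * t)) (by simp) (Or.inr (by simpa using ht))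
  simp only [compensatedExp, neg_mul, neg_neg, ← sub_eq_add_neg] at key
  rw [key]
  rcases lt_or_gt_of_ne ht with h | h
  · have hlog : Complex.log (-(Complex.I * t)) = Real.log |t| + π / 2 * Complex.I := by
      rw [abs_of_neg h, ← Complex.log_I, ← Complex.log_ofReal_mul (neg_pos.2 h) Complex.I_ne_zero]
      congr 1; push_cast; ring
    rw [hlog, abs_of_neg h]
    push_cast
    linear_combination (-(t * π / 2) : ℂ) * Complex.I_sq
  · have hlog : Complex.log (-(Complex.I * t)) = Real.log |t| - π / 2 * Complex.I := by
      have hI : -(Complex.I * t) = t * -Complex.I := by ring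
      rw [abs_of_pos h, hI, Complex.log_ofReal_mul h (neg_ne_zero.2 Complex.I_ne_zero),
        Complex.log_neg_I]
      ring
    rw [hlog, abs_of_pos h]
    push_cast
    linear_combination ((t * π / 2) : ℂ) * Complex.I_sq
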